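/- For all vectors R1, R2, Rb1, Rb2 ∈ ℝ³, the identity Rm²·Gb2·(Rm²·Gb2 + Rx·ξ) − (Rm² + Rx²)·(ξ² + Ξ²) = Rm⁴·Gb2·(S + Rx·Rbx − Ω) holds, where Ξ = (R1·(R1−R2))(Rb1·(Rb1+Rb2)) + (R2·(R1−R2))(Rb2·(Rb1+Rb2)), ξ = Rx·Rbp² + Rbx·Rm², and Gb2 = Rbp² − T + 2·Rx·Rbx. (This is the simplification showing that the linear coefficient ϖ of the characteristic polynomial of the dual certificate for procedure B equals (1/4)(−Ω + S + Rx·Rbx).) -/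

import Mathlib

noncomputable section

open Real

/-- Euclidean dot product on ℝ³ (vectors as `Fin 3 → ℝ`). -/
def dot3 (v w : Fin 3 → ℝ) : ℝ := v 0 * w 0 + v 1 * w 1 + v 2 * w 2

/-- Cross product on ℝ³. -/
def cross3 (v w : Fin 3 → ℝ) : Fin 3 → ℝ :=
  ![v 1 * w 2 - v 2 * w 1, v 2 * w 0 - v 0 * w 2, v 0 * w 1 - v 1 * w 0]

/-- Euclidean norm on ℝ³. -/
def norm3 (v : Fin 3 → ℝ) : ℝ := Real.sqrt (dot3 v v)

/-- `T = Σ_{i,j∈{1,2}} (1 − Ri·Rj)(Rbi·Rbj)`. -/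
def Tq (R1 R2 Rb1 Rb2 : Fin 3 → ℝ) : ℝ :=
  (1 - dot3 R1 R1) * dot3 Rb1 Rb1 + (1 - dot3 R1 R2) * dot3 Rb1 Rb2
    + (1 - dot3 R2 R1) * dot3 Rb2 Rb1 + (1 - dot3 R2 R2) * dot3 Rb2 Rb2

/-- `S = √(T² + 4·Rbx²·(Rm² − Rx²))`. -/
def Sq (R1 R2 Rb1 Rb2 : Fin 3 → ℝ) : ℝ :=
  Real.sqrt ((Tq R1 R2 Rb1 Rb2) ^ 2
    + 4 * (norm3 (cross3 Rb1 Rb2)) ^ 2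
      * ((norm3 (R1 - R2)) ^ 2 - (norm3 (cross3 R1 R2)) ^ 2))

/-- Indicator function `Ω = S + T − 2·Rbx·Rx`. -/
def Omega (R1 R2 Rb1 Rb2 : Fin 3 → ℝ) : ℝ :=
  Sq R1 R2 Rb1 Rb2 + Tq R1 R2 Rb1 Rb2
    - 2 * norm3 (cross3 Rb1 Rb2) * norm3 (cross3 R1 R2)

/-- `Ξ = (R1·(R1−R2))(Rb1·(Rb1+Rb2)) + (R2·(R1−R2))(Rb2·(Rb1+Rb2))`. -/
def Xi (R1 R2 Rb1 Rb2 : Fin 3 → ℝ) : ℝ :=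
  dot3 R1 (R1 - R2) * dot3 Rb1 (Rb1 + Rb2) + dot3 R2 (R1 - R2) * dot3 Rb2 (Rb1 + Rb2)

/-- `ξ = Rx·Rbp² + Rbx·Rm²`. -/
def xiq (R1 R2 Rb1 Rb2 : Fin 3 → ℝ) : ℝ :=
  norm3 (cross3 R1 R2) * (norm3 (Rb1 + Rb2)) ^ 2
    + norm3 (cross3 Rb1 Rb2) * (norm3 (R1 - R2)) ^ 2

/-- `Γ_b² = Rbp² − T + 2·Rx·Rbx`. -/
def Gb2 (R1 R2 Rb1 Rb2 : Fin 3 → ℝ) : ℝ :=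
  (norm3 (Rb1 + Rb2)) ^ 2 - Tq R1 R2 Rb1 Rb2
    + 2 * norm3 (cross3 R1 R2) * norm3 (cross3 Rb1 Rb2)

theorem norm3_sq (v : Fin 3 → ℝ) : norm3 v ^ 2 = dot3 v v :=
  Real.sq_sqrt (by unfold dot3; nlinarith [sq_nonneg (v 0), sq_nonneg (v 1), sq_nonneg (v 2)])

theorem dot3_comm (v w : Fin 3 → ℝ) : dot3 v w = dot3 w v := by
  unfold dot3; ring

/-- Lagrange's identity. -/
theorem norm3_cross3_sq (v w : Fin 3 → ℝ) :
    norm3 (cross3 v w) ^ 2 = dot3 v v * dot3 w w - dot3 v w ^ 2 := by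
  rw [norm3_sq]
  simp only [dot3, cross3, Matrix.cons_val]
  ring

theorem dot3_add_right (u v w : Fin 3 → ℝ) : dot3 u (v + w) = dot3 u v + dot3 u w := by
  simp only [dot3, Pi.add_apply]; ring

theorem dot3_sub_right (u v w : Fin 3 → ℝ) : dot3 u (v - w) = dot3 u v - dot3 u w := by
  simp only [dot3, Pi.sub_apply]; ring

theorem norm3_add_sq (v w : Fin 3 → ℝ) :
    norm3 (v + w) ^ 2 = dot3 v v + 2 * dot3 v w + dot3 w w := by
  rw [norm3_sq]; simp only [dot3, Pi.add_apply]; ring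

theorem norm3_sub_sq (v w : Fin 3 → ℝ) :
    norm3 (v - w) ^ 2 = dot3 v v - 2 * dot3 v w + dot3 w w := by
  rw [norm3_sq]; simp only [dot3, Pi.sub_apply]; ring

theorem xiq_sq_add_Xi_sq (R1 R2 Rb1 Rb2 : Fin 3 → ℝ) :
    xiq R1 R2 Rb1 Rb2 ^ 2 + Xi R1 R2 Rb1 Rb2 ^ 2
      = norm3 (R1 - R2) ^ 2 * norm3 (Rb1 + Rb2) ^ 2 * Gb2 R1 R2 Rb1 Rb2 := by
  have hx := norm3_cross3_sq R1 R2
  have hb := norm3_cross3_sq Rb1 Rb2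
  simp only [xiq, Xi, Gb2, Tq, norm3_add_sq, norm3_sub_sq, dot3_add_right, dot3_sub_right,
    dot3_comm R2 R1, dot3_comm Rb2 Rb1]
  linear_combination (dot3 Rb1 Rb1 + 2 * dot3 Rb1 Rb2 + dot3 Rb2 Rb2) ^ 2 * hx
    + (dot3 R1 R1 - 2 * dot3 R1 R2 + dot3 R2 R2) ^ 2 * hb

/-- the identity
`Rm²·Γ_b²·(Rm²·Γ_b² + Rx·ξ) − (Rm² + Rx²)·(ξ² + Ξ²) = Rm⁴·Γ_b²·(S + Rx·Rbx − Ω)`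
holds for all vectors. -/
theorem stmt_9 (R1 R2 Rb1 Rb2 : Fin 3 → ℝ) :
    (norm3 (R1 - R2)) ^ 2 * Gb2 R1 R2 Rb1 Rb2 *
        ((norm3 (R1 - R2)) ^ 2 * Gb2 R1 R2 Rb1 Rb2
          + norm3 (cross3 R1 R2) * xiq R1 R2 Rb1 Rb2)
      - ((norm3 (R1 - R2)) ^ 2 + (norm3 (cross3 R1 R2)) ^ 2) *
          ((xiq R1 R2 Rb1 Rb2) ^ 2 + (Xi R1 R2 Rb1 Rb2) ^ 2)
      = (norm3 (R1 - R2)) ^ 4 * Gb2 R1 R2 Rb1 Rb2 *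
          (Sq R1 R2 Rb1 Rb2
            + norm3 (cross3 R1 R2) * norm3 (cross3 Rb1 Rb2)
            - Omega R1 R2 Rb1 Rb2) := by
  rw [xiq_sq_add_Xi_sq]
  simp only [Omega, xiq, Gb2]
  ring
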